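/- For every β ≥ 0 the sequence (Z̃^{NE,*}_{β,L})_{L∈ℕ} is log super-additive, i.e., Z̃^{NE,*}_{β,L+L'} ≥ Z̃^{NE,*}_{β,L} · Z̃^{NE,*}_{β,L'} for all L, L' ∈ ℕ. Consequently the free energy F̃^{NE,*}(β) := lim_{L→∞} (1/L) log Z̃^{NE,*}_{β,L} exists, equals sup_{L∈ℕ} (1/L) log Z̃^{NE,*}_{β,L}, and is finite. -/

import Mathlib

open Filter

/-! ## Paths on `ℤ²` encoded by direction sequences -/

/-- The four unit steps of `ℤ²`: right, left, up, down. -/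
def dirs : Fin 4 → ℤ × ℤ := ![(1, 0), (-1, 0), (0, 1), (0, -1)]

/-- The list of steps (increments) of an `L`-step path encoded by a direction sequence. -/
def stepsOf {L : ℕ} (s : Fin L → Fin 4) : List (ℤ × ℤ) := (List.ofFn s).map dirs

/-- The position `w_i` of the path after `i` steps; `w_0 = (0,0)`. -/
def pt (steps : List (ℤ × ℤ)) (i : ℕ) : ℤ × ℤ := (steps.take i).sum

/-- Self-avoiding: the sites `w_0, …, w_L` are pairwise distinct. -/
def IsSA (steps : List (ℤ × ℤ)) : Prop :=
  ∀ i ≤ steps.length, ∀ j ≤ steps.length, pt steps i = pt steps j → i = j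

/-- Prudent: no step points towards a previously visited site, i.e. for every
`i < L`, every `k ≥ 1` and every `j ≤ i`, `w_i + k (w_{i+1} - w_i) ≠ w_j`. -/
def IsPrudent (steps : List (ℤ × ℤ)) : Prop :=
  ∀ i < steps.length, ∀ k : ℕ, 1 ≤ k → ∀ j ≤ i,
    pt steps i + (k : ℤ) • steps.getD i (0, 0) ≠ pt steps j

/-- Twice the midpoint `u_{i+1}` of step number `i` (0-indexed): `w_i + w_{i+1}`. -/
def dmid (steps : List (ℤ × ℤ)) (i : ℕ) : ℤ × ℤ := pt steps i + pt steps (i + 1)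

/-- The Hamiltonian `H(w)`: the number of pairs `1 ≤ i < j ≤ L` with
`‖u_i - u_j‖ = 1`, i.e. whose doubled midpoints differ by a vector of squared
Euclidean norm `4`. -/
noncomputable def Ham (steps : List (ℤ × ℤ)) : ℕ :=
  ((Finset.range steps.length ×ˢ Finset.range steps.length).filter fun p =>
      p.1 < p.2 ∧ (dmid steps p.1 - dmid steps p.2).1 ^ 2 +
        (dmid steps p.1 - dmid steps p.2).2 ^ 2 = 4).card

/-! ## IPSAW -/

open scoped Classical in
/-- `Ω_L^PSAW`: the set of `L`-step prudent paths. -/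
noncomputable def psawFinset (L : ℕ) : Finset (Fin L → Fin 4) :=
  Finset.univ.filter fun s => IsPrudent (stepsOf s)

/-- `Z_{β,L}`: the partition function of IPSAW. -/
noncomputable def Zpsaw (β : ℝ) (L : ℕ) : ℝ :=
  ∑ s ∈ psawFinset L, Real.exp (β * (Ham (stepsOf s) : ℝ))

/-! ## Partially directed paths, oriented blocks and NE-prudent paths -/

/-- The vertical run of steps corresponding to a (signed) stretch `ℓ`. -/
def vrun (ℓ : ℤ) : List (ℤ × ℤ) := List.replicate ℓ.natAbs (if 0 ≤ ℓ then (0, 1) else (0, -1))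

/-- The horizontal run of steps corresponding to a (signed) stretch `ℓ`. -/
def hrun (ℓ : ℤ) : List (ℤ × ℤ) := List.replicate ℓ.natAbs (if 0 ≤ ℓ then (1, 0) else (-1, 0))

/-- The west-east partially directed path with stretch sequence `ℓs`: vertical
runs separated by single horizontal inter-stretch steps. -/
def weSteps (ℓs : List ℤ) : List (ℤ × ℤ) := List.intercalate [(1, 0)] (ℓs.map vrun)

/-- The south-north partially directed path with stretch sequence `ℓs`: horizontal
runs separated by single vertical inter-stretch steps. -/
def snSteps (ℓs : List ℤ) : List (ℤ × ℤ) := List.intercalate [(0, 1)] (ℓs.map hrun)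

/-- The upper exit condition: `ℓ_1 + ⋯ + ℓ_N > max_{0 ≤ i < N} (ℓ_1 + ⋯ + ℓ_i)`. -/
def upperExit (ℓs : List ℤ) : Prop := ∀ i < ℓs.length, (ℓs.take i).sum < ℓs.sum

/-- A block of given type: `true` = west-east, `false` = south-north. -/
def blockSteps : Bool → List ℤ → List (ℤ × ℤ)
  | true, ℓs => weSteps ℓs
  | false, ℓs => snSteps ℓs

/-- The concatenation of a sequence of blocks of alternating type, starting with
type `b`. -/
def neSteps : Bool → List (List ℤ) → List (ℤ × ℤ)
  | _, [] => []
  | b, ℓs :: rest => blockSteps b ℓs ++ neSteps (!b) rest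

/-- Block data of an NE-prudent path: a nonempty sequence of nonempty stretch
sequences, all blocks but the last satisfying the upper exit condition, and all
blocks but the first having a negative first stretch. -/
def IsNEData (bs : List (List ℤ)) : Prop :=
  bs ≠ [] ∧ (∀ ℓs ∈ bs, ℓs ≠ []) ∧
  (∀ i : ℕ, i + 1 < bs.length → upperExit (bs.getD i [])) ∧
  (∀ i : ℕ, 0 < i → i < bs.length → (bs.getD i []).headI < 0)

/-- An NE-prudent path: a prudent path obtained as the concatenation of oriented
blocks of alternating type as prescribed by `IsNEData`. -/
def IsNEPath (steps : List (ℤ × ℤ)) : Prop :=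
  IsPrudent steps ∧ ∃ (b : Bool) (bs : List (List ℤ)), IsNEData bs ∧ neSteps b bs = steps

open scoped Classical in
/-- `Ω_L^NE`: the set of `L`-step NE-prudent paths. -/
noncomputable def neFinset (L : ℕ) : Finset (Fin L → Fin 4) :=
  Finset.univ.filter fun s => IsNEPath (stepsOf s)

/-- `Z^NE_{β,L}`: the partition function of NE-IPSAW. -/
noncomputable def Zne (β : ℝ) (L : ℕ) : ℝ :=
  ∑ s ∈ neFinset L, Real.exp (β * (Ham (stepsOf s) : ℝ))

/-! ## Starred and tilde NE sets -/

/-- Block data where all blocks, including the last one, satisfy the upper exit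
condition. -/
def IsNEStarData (bs : List (List ℤ)) : Prop :=
  bs ≠ [] ∧ (∀ ℓs ∈ bs, ℓs ≠ []) ∧
  (∀ i : ℕ, i < bs.length → upperExit (bs.getD i [])) ∧
  (∀ i : ℕ, 0 < i → i < bs.length → (bs.getD i []).headI < 0)

/-- Membership in `Ω_L^{NE,*}`. -/
def IsNEStar (steps : List (ℤ × ℤ)) : Prop :=
  IsPrudent steps ∧ ∃ (b : Bool) (bs : List (List ℤ)), IsNEStarData bs ∧ neSteps b bs = steps

/-- Membership in `Ω̃_L^{NE,*}`: moreover the first stretch of the path has length `0`. -/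
def IsNETilde (steps : List (ℤ × ℤ)) : Prop :=
  IsPrudent steps ∧ ∃ (b : Bool) (bs : List (List ℤ)), IsNEStarData bs ∧
    bs.headI.headI = 0 ∧ neSteps b bs = steps

open scoped Classical in
noncomputable def neStarFinset (L : ℕ) : Finset (Fin L → Fin 4) :=
  Finset.univ.filter fun s => IsNEStar (stepsOf s)

open scoped Classical in
noncomputable def neTildeFinset (L : ℕ) : Finset (Fin L → Fin 4) :=
  Finset.univ.filter fun s => IsNETilde (stepsOf s)

/-- `Z^{NE,*}_{β,L}`. -/
noncomputable def Zstar (β : ℝ) (L : ℕ) : ℝ :=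
  ∑ s ∈ neStarFinset L, Real.exp (β * (Ham (stepsOf s) : ℝ))

/-- `Z̃^{NE,*}_{β,L}`. -/
noncomputable def Ztilde (β : ℝ) (L : ℕ) : ℝ :=
  ∑ s ∈ neTildeFinset L, Real.exp (β * (Ham (stepsOf s) : ℝ))

/-! ## IPDSAW and ISAW -/

/-- A west-east partially directed self-avoiding path: increments in
`{(1,0),(0,1),(0,-1)}` and self-avoiding. -/
def IsPD (steps : List (ℤ × ℤ)) : Prop :=
  (∀ d ∈ steps, d = (1, 0) ∨ d = (0, 1) ∨ d = (0, -1)) ∧ IsSA steps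

open scoped Classical in
/-- `Ω_L^PDSAW`. -/
noncomputable def pdFinset (L : ℕ) : Finset (Fin L → Fin 4) :=
  Finset.univ.filter fun s => IsPD (stepsOf s)

/-- `Z^IPDSAW_{β,L}`. -/
noncomputable def Zipd (β : ℝ) (L : ℕ) : ℝ :=
  ∑ s ∈ pdFinset L, Real.exp (β * (Ham (stepsOf s) : ℝ))

open scoped Classical in
/-- `Ω_L^SAW`. -/
noncomputable def sawFinset (L : ℕ) : Finset (Fin L → Fin 4) :=
  Finset.univ.filter fun s => IsSA (stepsOf s)

/-- `Z^ISAW_{β,L}`. -/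
noncomputable def Zisaw (β : ℝ) (L : ℕ) : ℝ :=
  ∑ s ∈ sawFinset L, Real.exp (β * (Ham (stepsOf s) : ℝ))

/-! ## Orientations of two-sided paths -/

/-- The four possible general orientations of a two-sided prudent path. -/
inductive Orient | NE | NW | SE | SW
deriving DecidableEq

/-- The axial symmetry of `ℤ²` turning an NE-oriented object into an
`x`-oriented one, acting on steps. -/
def osym : Orient → ℤ × ℤ → ℤ × ℤ
  | Orient.NE, d => d
  | Orient.NW, d => (-d.1, d.2)
  | Orient.SE, d => (d.1, -d.2)
  | Orient.SW, d => (-d.1, -d.2)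

/-! ## Blocks of either type, treated uniformly -/

/-- The positive stretch direction of blocks of type `b`; the inter-stretch steps of such a
block are `fwd !b`. -/
def fwd (b : Bool) : ℤ × ℤ := if b then (0, 1) else (1, 0)

/-- The coordinate measured along `fwd b`. -/
def coord (b : Bool) : ℤ × ℤ →+ ℤ := if b then AddMonoidHom.snd ℤ ℤ else AddMonoidHom.fst ℤ ℤ

/-- The run of steps of a signed stretch in a block of type `b`. -/
def run (b : Bool) (ℓ : ℤ) : List (ℤ × ℤ) :=
  List.replicate ℓ.natAbs (if 0 ≤ ℓ then fwd b else -fwd b)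

@[simp] lemma coord_fwd (b : Bool) : coord b (fwd b) = 1 := by cases b <;> simp [coord, fwd]

@[simp] lemma coord_fwd_not (b : Bool) : coord b (fwd !b) = 0 := by cases b <;> simp [coord, fwd]

@[simp] lemma coord_not_fwd (b : Bool) : coord (!b) (fwd b) = 0 := by cases b <;> simp [coord, fwd]

lemma fwd_injective : Function.Injective fwd := by
  intro a b h
  cases a <;> cases b <;> simp_all [fwd]

lemma fwd_ne_fwd_not (b : Bool) : fwd b ≠ fwd !b := fun h => by
  simpa using fwd_injective h

lemma blockSteps_eq_intercalate (b : Bool) (ℓs : List ℤ) :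
    blockSteps b ℓs = List.intercalate [fwd !b] (ℓs.map (run b)) := by
  cases b
  · simp only [blockSteps, snSteps]
    congr 2
  · simp only [blockSteps, weSteps]
    congr 2

@[simp] lemma blockSteps_nil (b : Bool) : blockSteps b [] = [] := by
  simp [blockSteps_eq_intercalate]

@[simp] lemma blockSteps_singleton (b : Bool) (x : ℤ) : blockSteps b [x] = run b x := by
  simp [blockSteps_eq_intercalate]

lemma blockSteps_cons (b : Bool) (x : ℤ) {t : List ℤ} (ht : t ≠ []) :
    blockSteps b (x :: t) = run b x ++ fwd (!b) :: blockSteps b t := by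
  rw [blockSteps_eq_intercalate, List.map_cons, List.intercalate_cons_of_ne_nil (by simpa),
    blockSteps_eq_intercalate]
  simp

lemma blockSteps_append (b : Bool) {s t : List ℤ} (hs : s ≠ []) (ht : t ≠ []) :
    blockSteps b (s ++ t) = blockSteps b s ++ fwd (!b) :: blockSteps b t := by
  induction s with
  | nil => exact absurd rfl hs
  | cons x s ih =>
    rcases eq_or_ne s [] with rfl | hs'
    · simp [blockSteps_cons b x ht]
    · rw [List.cons_append, blockSteps_cons b x (by simp [hs']), ih hs', blockSteps_cons b x hs']
      simp

@[simp] lemma run_zero (b : Bool) : run b 0 = [] := rfl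

lemma run_one (b : Bool) : run b 1 = [fwd b] := rfl

lemma run_add (b : Bool) {x y : ℤ} (hx : 0 ≤ x) (hy : 0 ≤ y) :
    run b (x + y) = run b x ++ run b y := by
  simp [run, hx, hy, add_nonneg hx hy, Int.natAbs_add_of_nonneg hx hy]

lemma coord_sum_run (b : Bool) (x : ℤ) : coord b (run b x).sum = x := by
  rcases le_or_gt 0 x with h | h
  · simp only [run, h, if_true, List.sum_replicate, map_nsmul, coord_fwd]
    simp [abs_of_nonneg h]
  · simp only [run, h.not_ge, if_false, List.sum_replicate, map_nsmul, map_neg, coord_fwd]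
    simp [abs_of_neg h]

lemma blockSteps_merge (b : Bool) (s t : List ℤ) {x y : ℤ} (hx : 0 ≤ x) (hy : 0 ≤ y) :
    blockSteps b (s ++ [x]) ++ blockSteps b (y :: t) = blockSteps b (s ++ (x + y) :: t) := by
  have key : run b x ++ blockSteps b (y :: t) = blockSteps b ((x + y) :: t) := by
    rcases eq_or_ne t [] with rfl | ht
    · simp [run_add b hx hy]
    · simp [blockSteps_cons b _ ht, run_add b hx hy]
  rcases eq_or_ne s [] with rfl | hs
  · simpa using key
  · rw [blockSteps_append b hs (by simp), blockSteps_append b hs (by simp), ← key]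
    simp

lemma blockSteps_replicate_zero_append (b : Bool) (j : ℕ) {t : List ℤ} (ht : t ≠ []) :
    blockSteps b (List.replicate j 0 ++ t) = List.replicate j (fwd !b) ++ blockSteps b t := by
  induction j with
  | zero => simp
  | succ j ih =>
    rw [List.replicate_succ, List.cons_append, blockSteps_cons b _ (by simp [ht]), ih]
    simp [List.replicate_succ]

/-! ## The upper exit condition -/

lemma upperExit_append {s t : List ℤ} (hs : ∀ i < s.length, (s.take i).sum < s.sum + t.sum)
    (ht : upperExit t) : upperExit (s ++ t) := by
  intro i hi
  rcases lt_or_ge i s.length with h | h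
  · simpa [List.take_append, Nat.sub_eq_zero_of_le h.le] using hs i h
  · have := ht (i - s.length) (by simp at hi; omega)
    simpa [List.take_append, List.take_of_length_le h] using this

lemma upperExit.sum_pos {s : List ℤ} (h : upperExit s) (hs : s ≠ []) : 0 < s.sum := by
  simpa using h 0 (List.length_pos_iff.2 hs)

lemma upperExit.of_append {s t : List ℤ} (h : upperExit (s ++ t)) : upperExit t := by
  intro i hi
  simpa [List.take_append, List.take_of_length_le (Nat.le_add_right s.length i)] using
    h (s.length + i) (by simpa using hi)

lemma upperExit.last_pos {s : List ℤ} {x : ℤ} (h : upperExit (s ++ [x])) : 0 < x := by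
  simpa using h.of_append.sum_pos (by simp)

lemma upperExit_singleton {x : ℤ} (hx : 0 < x) : upperExit [x] := by
  intro i hi
  obtain rfl : i = 0 := by simpa using hi
  simpa

lemma upperExit_replicate_zero_append (j : ℕ) {t : List ℤ} (ht : upperExit t) (h : t ≠ []) :
    upperExit (List.replicate j 0 ++ t) :=
  upperExit_append (by intro i hi; simpa using ht.sum_pos h) ht

lemma upperExit_merge {s t : List ℤ} {x y : ℤ} (hs : upperExit (s ++ [x]))
    (ht : upperExit (y :: t)) : upperExit (s ++ (x + y) :: t) := by
  have hpos : 0 < y + t.sum := by simpa using ht.sum_pos (by simp)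
  refine upperExit_append ?_ ?_
  · intro i hi
    have := hs i (by simp; omega)
    simp [List.take_append, Nat.sub_eq_zero_of_le hi.le] at this
    simp
    omega
  · have hx := hs.last_pos
    intro i hi
    cases i with
    | zero => simp; omega
    | succ i => simpa [add_assoc] using ht (i + 1) (by simpa using hi)

/-- A block whose first stretch is not positive and which satisfies the upper exit condition has
at least two stretches, the last one being positive. -/
lemma upperExit.exists_eq {s : List ℤ} (h : upperExit s) (hs : s ≠ []) (h0 : s.headI ≤ 0) :
    ∃ x t y, s = x :: t ++ [y] ∧ 0 < y := by
  obtain ⟨t, y, rfl⟩ := List.eq_nil_or_concat s |>.resolve_left hs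
  rw [List.concat_eq_append] at *
  have hy := h.last_pos
  cases t with
  | nil => simp at h0; omega
  | cons x t => exact ⟨x, t, y, rfl, hy⟩

/-! ## Paths of `Ω̃^{NE,*}` with prescribed type of the last block -/

/-- `NETildeOf b w`: the step sequence `w` is a concatenation of oriented blocks of alternating
type with first stretch `0`, all satisfying the upper exit condition, the last one of type `b`. -/
inductive NETildeOf : Bool → List (ℤ × ℤ) → Prop
  | first (b : Bool) (ℓs : List ℤ) : ℓs ≠ [] → ℓs.headI = 0 → upperExit ℓs →
      NETildeOf b (blockSteps b ℓs)
  | next (b : Bool) (w : List (ℤ × ℤ)) (ℓs : List ℤ) : NETildeOf (!b) w → ℓs ≠ [] →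
      ℓs.headI < 0 → upperExit ℓs → NETildeOf b (w ++ blockSteps b ℓs)

lemma NETildeOf.merge {b : Bool} {w : List (ℤ × ℤ)} (h : NETildeOf b w) {y : ℤ} {t : List ℤ}
    (hy : 0 ≤ y) (ht : upperExit (y :: t)) : NETildeOf b (w ++ blockSteps b (y :: t)) := by
  cases h with
  | first _ ℓs h1 h2 h3 =>
    obtain ⟨x, s, z, rfl, hz⟩ := h3.exists_eq h1 h2.le
    rw [blockSteps_merge b _ _ hz.le hy]
    exact .first b _ (by simp) (by simpa using h2) (upperExit_merge h3 ht)
  | next _ w ℓs h0 h1 h2 h3 =>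
    obtain ⟨x, s, z, rfl, hz⟩ := h3.exists_eq h1 h2.le
    rw [List.append_assoc, blockSteps_merge b _ _ hz.le hy]
    exact .next b _ _ h0 (by simp) (by simpa using h2) (upperExit_merge h3 ht)

lemma NETildeOf.append_fwd {b : Bool} {w : List (ℤ × ℤ)} (h : NETildeOf b w) :
    NETildeOf b (w ++ [fwd b]) := by
  simpa [run_one] using h.merge zero_le_one (upperExit_singleton zero_lt_one)

lemma NETildeOf.append_neSteps {b : Bool} {w : List (ℤ × ℤ)} (h : NETildeOf b w)
    (bs : List (List ℤ)) (hne : ∀ ℓs ∈ bs, ℓs ≠ []) (hexit : ∀ ℓs ∈ bs, upperExit ℓs)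
    (hneg : ∀ ℓs ∈ bs, ℓs.headI < 0) : ∃ b', NETildeOf b' (w ++ neSteps (!b) bs) := by
  induction bs generalizing b w with
  | nil => exact ⟨b, by simpa [neSteps] using h⟩
  | cons ℓs bs ih =>
    simp only [List.mem_cons, forall_eq_or_imp] at hne hexit hneg
    have h' : NETildeOf (!b) (w ++ blockSteps (!b) ℓs) :=
      .next _ _ _ (by simpa using h) hne.1 hneg.1 hexit.1
    simpa [neSteps] using ih h' hne.2 hexit.2 hneg.2

lemma isNEStarData_cons {ℓs : List ℤ} {bs : List (List ℤ)} :
    IsNEStarData (ℓs :: bs) ↔ (∀ m ∈ ℓs :: bs, m ≠ []) ∧ (∀ m ∈ ℓs :: bs, upperExit m) ∧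
      ∀ m ∈ bs, m.headI < 0 := by
  simp only [IsNEStarData, ne_eq, reduceCtorEq, not_false_eq_true, true_and]
  refine and_congr_right fun _ => and_congr ?_ ?_
  · rw [List.forall_mem_iff_getElem]
    exact forall₂_congr fun i hi => by rw [List.getD_eq_getElem _ _ hi]
  · rw [List.forall_mem_iff_getElem]
    refine ⟨fun h i hi => ?_, fun h i hi hi' => ?_⟩
    · simpa [hi] using h (i + 1) (by simp) (by simpa using hi)
    · obtain ⟨i, rfl⟩ := Nat.exists_eq_succ_of_ne_zero hi.ne'
      have hi'' : i < bs.length := by simpa using hi'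
      simpa [hi''] using h i hi''

lemma neSteps_append_singleton (b : Bool) (bs : List (List ℤ)) (ℓs : List ℤ) :
    neSteps b (bs ++ [ℓs]) = neSteps b bs ++ blockSteps (b ^^ bs.length.bodd) ℓs := by
  induction bs generalizing b with
  | nil => simp [neSteps]
  | cons m bs ih =>
    simp only [List.cons_append, neSteps, ih, List.append_assoc, List.length_cons, Nat.bodd_succ]
    cases b <;> simp

lemma NETildeOf.exists_data {b : Bool} {w : List (ℤ × ℤ)} (h : NETildeOf b w) :
    ∃ b₀ ℓs bs, IsNEStarData (ℓs :: bs) ∧ ℓs.headI = 0 ∧ neSteps b₀ (ℓs :: bs) = w ∧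
      b = (b₀ ^^ bs.length.bodd) := by
  induction h with
  | first b ℓs h1 h2 h3 =>
    exact ⟨b, ℓs, [], isNEStarData_cons.2 (by simp [h1, h3]), h2, by simp [neSteps], by simp⟩
  | next b w ms _ h1 h2 h3 ih =>
    obtain ⟨b₀, ℓs, bs, hd, h0, rfl, hb⟩ := ih
    refine ⟨b₀, ℓs, bs ++ [ms], ?_, h0, ?_, ?_⟩
    · rw [isNEStarData_cons] at hd ⊢
      simp only [List.mem_cons, List.mem_append, List.not_mem_nil, or_false] at hd ⊢
      refine ⟨?_, ?_, ?_⟩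
      · rintro m (rfl | hm | rfl)
        exacts [hd.1 _ (.inl rfl), hd.1 _ (.inr hm), h1]
      · rintro m (rfl | hm | rfl)
        exacts [hd.2.1 _ (.inl rfl), hd.2.1 _ (.inr hm), h3]
      · rintro m (hm | rfl)
        exacts [hd.2.2 _ hm, h2]
    · rw [← List.cons_append, neSteps_append_singleton]
      congr 2
      revert hb
      cases b <;> cases b₀ <;> cases h : bs.length.bodd <;> simp [h]
    · revert hb
      cases b <;> cases b₀ <;> cases h : bs.length.bodd <;> simp [h]

/-! ## Prudence -/

/-- A step sequence can be extended by steps `d` without looking back at itself. -/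
def Faces (w : List (ℤ × ℤ)) (d : ℤ × ℤ) : Prop :=
  ∀ k : ℕ, 1 ≤ k → ∀ p, p <+: w → w.sum + (k : ℤ) • d ≠ p.sum

lemma IsPrudent.append_step {w : List (ℤ × ℤ)} {d : ℤ × ℤ} (hw : IsPrudent w) (hd : Faces w d) :
    IsPrudent (w ++ [d]) := by
  intro i hi k hk j hj
  rw [List.length_append, List.length_singleton] at hi
  have hpt : ∀ m ≤ w.length, pt (w ++ [d]) m = pt w m := fun m hm => by
    rw [pt, List.take_append_of_le_length hm, pt]
  rcases Nat.lt_succ_iff_lt_or_eq.1 hi with h | rfl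
  · rw [hpt i h.le, hpt j (hj.trans h.le), List.getD_append _ _ _ _ h]
    exact hw i h k hk j hj
  · rw [hpt _ le_rfl, hpt j hj]
    simpa [pt] using hd k hk _ (List.take_prefix j w)

lemma Faces.append_step {w : List (ℤ × ℤ)} {d : ℤ × ℤ} (hd : Faces w d) (h0 : d ≠ 0) :
    Faces (w ++ [d]) d := by
  intro k hk p hp
  have hsum : (w ++ [d]).sum + (k : ℤ) • d = w.sum + ((k + 1 : ℕ) : ℤ) • d := by
    simp only [List.sum_append, List.sum_singleton, Nat.cast_add, Nat.cast_one, add_smul, one_smul]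
    abel
  rcases List.prefix_concat_iff.1 hp with rfl | hp
  · rw [ne_eq, add_eq_left, smul_eq_zero]
    simp [h0]
    omega
  · rw [hsum]
    exact hd (k + 1) (by omega) p hp

lemma IsPrudent.append_replicate {w : List (ℤ × ℤ)} {d : ℤ × ℤ} (hw : IsPrudent w)
    (hd : Faces w d) (h0 : d ≠ 0) (n : ℕ) : IsPrudent (w ++ List.replicate n d) := by
  induction n generalizing w with
  | zero => simpa
  | succ n ih => simpa [List.replicate_succ] using ih (hw.append_step hd) (hd.append_step h0)

lemma prefix_append_iff {p v w : List (ℤ × ℤ)} :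
    p <+: v ++ w ↔ p <+: v ∨ ∃ q, q <+: w ∧ p = v ++ q := by
  constructor
  · rintro ⟨r, hr⟩
    rcases List.append_eq_append_iff.1 hr with ⟨u, rfl, -⟩ | ⟨u, rfl, rfl⟩
    · exact .inl ⟨u, rfl⟩
    · exact .inr ⟨u, ⟨r, rfl⟩, rfl⟩
  · rintro (h | ⟨q, h, rfl⟩)
    · exact h.trans (List.prefix_append _ _)
    · simpa using h

lemma coord_prefix_run (b : Bool) {x : ℤ} {p : List (ℤ × ℤ)} (hp : p <+: run b x) :
    coord (!b) p.sum = 0 ∧ coord b p.sum ≤ max 0 x ∧ (p ≠ run b x → 0 < x → coord b p.sum < x) := by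
  rw [run, List.prefix_replicate_iff] at hp
  obtain ⟨hlen, hp⟩ := hp
  rw [hp]
  generalize p.length = n at *
  rcases le_or_gt 0 x with h | h
  · simp only [run, h, if_true, List.sum_replicate, map_nsmul, coord_fwd, coord_not_fwd]
    refine ⟨by simp, by simp; omega, fun hne hx => ?_⟩
    have : n ≠ x.natAbs := by rintro rfl; exact hne rfl
    simp; omega
  · simp only [h.not_ge, if_false, List.sum_replicate, map_nsmul, map_neg, coord_fwd,
      coord_not_fwd]
    refine ⟨by simp, by simp, fun _ hx => by omega⟩

/-- A block may be appended to a prudent path whose endpoint is strictly ahead of all other sites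
in the direction of the inter-stretches of the block. -/
lemma IsPrudent.append_blockSteps {b : Bool} {w : List (ℤ × ℤ)} (hw : IsPrudent w)
    (hlt : ∀ p, p <+: w → p ≠ w → coord (!b) p.sum < coord (!b) w.sum) (ℓs : List ℤ) :
    IsPrudent (w ++ blockSteps b ℓs) ∧ ∀ p, p <+: w ++ blockSteps b ℓs →
      coord (!b) p.sum ≤ coord (!b) (w ++ blockSteps b ℓs).sum := by
  have hle : ∀ p, p <+: w → coord (!b) p.sum ≤ coord (!b) w.sum := fun p hp => by
    rcases eq_or_ne p w with rfl | h
    exacts [le_rfl, (hlt p hp h).le]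
  induction ℓs generalizing w with
  | nil => simpa using ⟨hw, hle⟩
  | cons x t ih =>
    have hrun : IsPrudent (w ++ run b x) := by
      have hd : ∀ d : ℤ × ℤ, coord (!b) d = 0 → d ≠ 0 → Faces w d := fun d hd h0 k hk p hp h => by
        rcases eq_or_ne p w with rfl | hne
        · rw [add_eq_left, smul_eq_zero] at h
          simp [h0] at h
          omega
        · have := hlt p hp hne
          rw [← h, map_add, map_zsmul, hd] at this
          simp at this
      have h0 : fwd b ≠ 0 := by cases b <;> simp [fwd]
      unfold run
      split_ifs
      · exact hw.append_replicate (hd _ (by simp) h0) h0 _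
      · exact hw.append_replicate (hd _ (by simp) (by simpa)) (by simpa) _
    have hle' : ∀ p, p <+: w ++ run b x → coord (!b) p.sum ≤ coord (!b) (w ++ run b x).sum := by
      intro p hp
      have h0 := (coord_prefix_run b (List.prefix_refl (run b x))).1
      rcases prefix_append_iff.1 hp with h | ⟨q, hq, rfl⟩
      · simpa [h0] using hle p h
      · simp [h0, (coord_prefix_run b hq).1]
    rcases eq_or_ne t [] with rfl | ht
    · rw [blockSteps_singleton]
      exact ⟨hrun, hle'⟩
    have hlt' : ∀ p, p <+: w ++ run b x ++ [fwd !b] → p ≠ w ++ run b x ++ [fwd !b] →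
        coord (!b) p.sum < coord (!b) (w ++ run b x ++ [fwd !b]).sum := by
      intro p hp hne
      have := hle' p ((List.prefix_concat_iff.1 hp).resolve_left hne)
      rw [List.sum_append, map_add, List.sum_singleton, coord_fwd]
      omega
    have hface : Faces (w ++ run b x) (fwd !b) := fun k hk p hp h => by
      have := hle' p hp
      rw [← h, map_add, map_zsmul, coord_fwd] at this
      simp at this
      omega
    rw [blockSteps_cons b x ht]
    simpa using ih (hrun.append_step hface) hlt' fun p hp => by
      rcases eq_or_ne p (w ++ run b x ++ [fwd !b]) with rfl | h
      exacts [le_rfl, (hlt' p hp h).le]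

lemma coord_sum_blockSteps (b : Bool) (ℓs : List ℤ) : coord b (blockSteps b ℓs).sum = ℓs.sum := by
  induction ℓs with
  | nil => simp
  | cons x t ih =>
    rcases eq_or_ne t [] with rfl | ht
    · simp [coord_sum_run]
    · simp [blockSteps_cons b x ht, coord_sum_run, ih]

/-- If all partial sums of the stretches lie below their total sum, then the endpoint of the
block lies strictly above all its other sites. -/
lemma coord_prefix_blockSteps_lt (b : Bool) {ℓs : List ℤ} (h : upperExit ℓs)
    {p : List (ℤ × ℤ)} (hp : p <+: blockSteps b ℓs) (hne : p ≠ blockSteps b ℓs) :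
    coord b p.sum < ℓs.sum := by
  induction ℓs generalizing p with
  | nil => simp_all
  | cons x t ih =>
    have h0 : 0 < x + t.sum := by simpa using h.sum_pos (by simp)
    rcases eq_or_ne t [] with rfl | ht
    · simp only [blockSteps_singleton] at hp hne
      simpa using (coord_prefix_run b hp).2.2 hne (by simpa using h0)
    have ht' : upperExit t := upperExit.of_append (s := [x]) h
    rw [blockSteps_cons b x ht] at hp hne
    rw [List.append_cons] at hp hne
    rcases prefix_append_iff.1 hp with hp | ⟨q, hq, rfl⟩
    · have hx := (ht'.sum_pos ht)
      rcases List.prefix_concat_iff.1 hp with rfl | hp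
      · simp [coord_sum_run, hx]
      · have := (coord_prefix_run b hp).2.1
        simp only [List.sum_cons]
        rcases le_total 0 x <;> simp_all <;> omega
    · have := ih ht' hq (by rintro rfl; exact hne rfl)
      simpa [coord_sum_run] using this

/-- The endpoint of such a path is the north-east corner of its bounding box and is strictly
ahead of all other sites in the stretch direction of the last block; the path is prudent. -/
lemma NETildeOf.prudent_and_corner {b : Bool} {w : List (ℤ × ℤ)} (h : NETildeOf b w) :
    IsPrudent w ∧ (∀ p, p <+: w → p ≠ w → coord b p.sum < coord b w.sum) ∧
      ∀ p, p <+: w → coord (!b) p.sum ≤ coord (!b) w.sum := by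
  induction h with
  | first b ℓs h1 h2 h3 =>
    have h := IsPrudent.append_blockSteps (b := b) (w := []) (by intro i hi; simp at hi)
      (by simp) ℓs
    simp only [List.nil_append] at h
    refine ⟨h.1, fun p hp hne => ?_, h.2⟩
    rw [coord_sum_blockSteps]
    exact coord_prefix_blockSteps_lt b h3 hp hne
  | next b w ℓs h0 h1 h2 h3 ih =>
    obtain ⟨hw, hlt, hle⟩ := ih
    have h := hw.append_blockSteps hlt ℓs
    refine ⟨h.1, fun p hp hne => ?_, h.2⟩
    rw [Bool.not_not] at hle
    rw [List.sum_append, map_add, coord_sum_blockSteps]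
    rcases prefix_append_iff.1 hp with hp | ⟨q, hq, rfl⟩
    · have := h3.sum_pos h1
      have := hle p hp
      omega
    · have := coord_prefix_blockSteps_lt b h3 hq (by rintro rfl; exact hne rfl)
      simpa using this

theorem isNETilde_iff {w : List (ℤ × ℤ)} : IsNETilde w ↔ ∃ b, NETildeOf b w := by
  constructor
  · rintro ⟨-, b, bs, hd, h0, rfl⟩
    cases bs with
    | nil => exact absurd rfl hd.1
    | cons ℓs bs =>
      rw [isNEStarData_cons] at hd
      simp only [List.mem_cons, forall_eq_or_imp] at hd
      exact (NETildeOf.first b ℓs hd.1.1 h0 hd.2.1.1).append_neSteps bs hd.1.2 hd.2.1.2 hd.2.2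
  · rintro ⟨b, h⟩
    obtain ⟨b₀, ℓs, bs, hd, h0, hw, -⟩ := h.exists_data
    exact ⟨h.prudent_and_corner.1, b₀, ℓs :: bs, hd, h0, hw⟩

/-! ## Concatenation -/

/-- All steps point north or east. -/
def IsDirectedNE (w : List (ℤ × ℤ)) : Prop := ∀ d ∈ w, ∃ b, d = fwd b

lemma directed_blockSteps (b : Bool) {ℓs : List ℤ} (h : ∀ x ∈ ℓs, 0 ≤ x) :
    IsDirectedNE (blockSteps b ℓs) := by
  have hrun : ∀ x : ℤ, 0 ≤ x → IsDirectedNE (run b x) := fun x hx d hd => by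
    rw [run, if_pos hx] at hd
    exact ⟨b, List.eq_of_mem_replicate hd⟩
  induction ℓs with
  | nil => simp [IsDirectedNE]
  | cons x t ih =>
    simp only [List.mem_cons, forall_eq_or_imp] at h
    rcases eq_or_ne t [] with rfl | ht
    · simpa using hrun x h.1
    · intro d hd
      simp only [blockSteps_cons b x ht, List.mem_append, List.mem_cons] at hd
      rcases hd with hd | rfl | hd
      exacts [hrun x h.1 d hd, ⟨_, rfl⟩, ih h.2 d hd]

lemma blockSteps_eq_concat (b : Bool) {ℓs : List ℤ} (h : upperExit ℓs) (hne : ℓs ≠ [])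
    (h0 : ℓs.headI ≤ 0) : ∃ u, blockSteps b ℓs = u ++ [fwd b] := by
  obtain ⟨x, t, y, rfl, hy⟩ := h.exists_eq hne h0
  obtain ⟨n, hn⟩ := Nat.exists_eq_succ_of_ne_zero (Int.natAbs_ne_zero.2 hy.ne')
  rw [blockSteps_append b (by simp) (by simp), blockSteps_singleton, run, if_pos hy.le, hn,
    List.replicate_succ']
  exact ⟨_, by rw [← List.cons_append, ← List.append_assoc]⟩

lemma NETildeOf.eq_concat {b : Bool} {w : List (ℤ × ℤ)} (h : NETildeOf b w) :
    ∃ u, w = u ++ [fwd b] := by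
  cases h with
  | first _ ℓs h1 h2 h3 => exact blockSteps_eq_concat b h3 h1 h2.le
  | next _ w ℓs h0 h1 h2 h3 =>
    obtain ⟨u, hu⟩ := blockSteps_eq_concat b h3 h1 h2.le
    exact ⟨w ++ u, by rw [hu, List.append_assoc]⟩

/-- A directed path of this kind has a single block. -/
lemma NETildeOf.eq_cons_of_directed {b : Bool} {w : List (ℤ × ℤ)} (h : NETildeOf b w)
    (hw : IsDirectedNE w) : ∃ u, w = fwd (!b) :: u := by
  cases h with
  | first _ ℓs h1 h2 h3 =>
    obtain ⟨x, t, y, rfl, hy⟩ := h3.exists_eq h1 h2.le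
    obtain rfl : x = 0 := by simpa using h2
    exact ⟨_, by rw [List.cons_append, blockSteps_cons b _ (by simp)]; rfl⟩
  | next _ w ℓs h0 h1 h2 h3 =>
    obtain ⟨x, t, y, rfl, hy⟩ := h3.exists_eq h1 h2.le
    have hx : x < 0 := by simpa using h2
    obtain ⟨c, hc⟩ := hw (-fwd b) (by
      rw [List.cons_append, blockSteps_cons b _ (by simp)]
      simp [run, hx.not_ge, hx.ne])
    cases b <;> cases c <;> simp [fwd] at hc

lemma NETildeOf.append_replicate_append {b : Bool} {w : List (ℤ × ℤ)} (h : NETildeOf b w)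
    (j : ℕ) {t : List ℤ} (ht : upperExit t) (hne : t ≠ []) (hj : j = 0 → 0 ≤ t.headI) :
    NETildeOf b (w ++ List.replicate j (fwd !b) ++ blockSteps b t) := by
  rw [List.append_assoc, ← blockSteps_replicate_zero_append b j hne]
  have hexit := upperExit_replicate_zero_append j ht hne
  cases j with
  | zero =>
    cases t with
    | nil => exact absurd rfl hne
    | cons x t => exact h.merge (hj rfl) (by simpa using ht)
  | succ j => exact h.merge le_rfl hexit

/-- Appending a directed path yields a path of the same kind, up to a final run of
inter-stretches. -/
lemma NETildeOf.append_directed {b : Bool} {w : List (ℤ × ℤ)} (h : NETildeOf b w)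
    {v : List (ℤ × ℤ)} (hv : IsDirectedNE v) :
    ∃ w' j, NETildeOf b w' ∧ w ++ v = w' ++ List.replicate j (fwd !b) := by
  induction v using List.reverseRecOn with
  | nil => exact ⟨w, 0, h, by simp⟩
  | append_singleton v d ih =>
    obtain ⟨w', j, hw', heq⟩ := ih fun e he => hv e (by simp [he])
    obtain ⟨c, rfl⟩ := hv d (by simp)
    rcases eq_or_ne c b with rfl | hc
    · refine ⟨w ++ v ++ [fwd c], 0, ?_, by simp⟩
      rw [heq]
      simpa [run_one] using hw'.append_replicate_append j (upperExit_singleton zero_lt_one)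
        (by simp) (by simp)
    · obtain rfl : c = !b := by cases b <;> cases c <;> simp_all
      refine ⟨w', j + 1, hw', ?_⟩
      rw [List.replicate_succ', ← List.append_assoc, heq, List.append_assoc]

lemma NETildeOf.append_directed_fwd {b : Bool} {w : List (ℤ × ℤ)} (h : NETildeOf b w)
    {v : List (ℤ × ℤ)} (hv : IsDirectedNE v) : NETildeOf b (w ++ (v ++ [fwd b])) := by
  obtain ⟨w', j, hw', heq⟩ := h.append_directed hv
  rw [← List.append_assoc, heq]
  simpa [run_one] using hw'.append_replicate_append j (upperExit_singleton zero_lt_one)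
    (by simp) (by simp)

/-- Two paths can be concatenated, except possibly when the second one is directed and starts in
the direction in which the first one ends. -/
theorem NETildeOf.append {b c : Bool} {v w : List (ℤ × ℤ)} (hv : NETildeOf b v)
    (hw : NETildeOf c w) : (∃ b', NETildeOf b' (v ++ w)) ∨ c = !b ∧ IsDirectedNE w := by
  obtain ⟨b₀, ℓs, bs, hd, h0, rfl, hc⟩ := hw.exists_data
  rw [isNEStarData_cons] at hd
  simp only [List.mem_cons, forall_eq_or_imp] at hd
  obtain ⟨⟨hne, hne'⟩, ⟨hexit, hexit'⟩, hneg⟩ := hd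
  obtain ⟨x, s, y, rfl, hy⟩ := hexit.exists_eq hne h0.le
  obtain rfl : x = 0 := by simpa using h0
  rw [List.cons_append] at *
  rw [neSteps, ← List.append_assoc]
  generalize hms : s ++ [y] = ms at *
  have hms0 : ms ≠ [] := by simp [← hms]
  rcases eq_or_ne b₀ b with rfl | hb
  · exact .inl <| (hv.merge le_rfl hexit).append_neSteps bs hne' hexit' hneg
  obtain rfl : b₀ = !b := by cases b <;> cases b₀ <;> simp_all
  rw [Bool.not_not]
  obtain ⟨P, Q, rfl, hP, hQ⟩ : ∃ P Q, ms = P ++ Q ∧ (∀ x ∈ P, 0 ≤ x) ∧ (Q = [] ∨ Q.headI < 0) := by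
    clear hc hw hms hexit hne h0 hms0
    induction ms with
    | nil => exact ⟨[], [], by simp⟩
    | cons x t ih =>
      rcases lt_or_ge x 0 with hx | hx
      · exact ⟨[], x :: t, by simp [hx]⟩
      · obtain ⟨P, Q, rfl, hP, hQ⟩ := ih
        exact ⟨x :: P, Q, rfl, by simpa [hx] using hP, hQ⟩
  have hdir : IsDirectedNE (blockSteps (!b) (0 :: P)) := directed_blockSteps _ (by simpa using hP)
  rcases eq_or_ne Q [] with rfl | hQ0
  · rw [List.append_nil] at *
    cases bs with
    | nil => exact .inr ⟨by simpa using hc, by simpa [neSteps] using hdir⟩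
    | cons m bs =>
      left
      simp only [List.mem_cons, forall_eq_or_imp] at hne' hexit' hneg
      obtain ⟨u, hu⟩ := blockSteps_eq_concat (!b) hexit hne h0.le
      obtain ⟨w', j, hw', heq⟩ := hv.append_directed (v := u) fun d hd =>
        hdir d (by simp [hu, hd])
      have hm := hw'.append_replicate_append (j + 1) hexit'.1 hne'.1 (by simp)
      rw [List.replicate_succ', ← List.append_assoc, ← heq, List.append_assoc v, ← hu] at hm
      simpa [neSteps] using hm.append_neSteps bs hne'.2 hexit'.2 hneg.2
  · left
    have hQe : upperExit Q := upperExit.of_append (s := 0 :: P) hexit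
    have h1 := hv.append_directed_fwd hdir
    have h2 : NETildeOf (!b) _ :=
      .next (!b) _ Q (by simpa using h1) hQ0 (hQ.resolve_left hQ0) hQe
    rw [← List.cons_append, blockSteps_append _ (by simp) hQ0]
    simpa using h2.append_neSteps bs hne' hexit' hneg

/-! ## The Hamiltonian of a concatenation -/

/-- The set of pairs counted by the Hamiltonian. -/
def touchings (w : List (ℤ × ℤ)) : Finset (ℕ × ℕ) :=
  (Finset.range w.length ×ˢ Finset.range w.length).filter fun p =>
    p.1 < p.2 ∧ (dmid w p.1 - dmid w p.2).1 ^ 2 + (dmid w p.1 - dmid w p.2).2 ^ 2 = 4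

lemma mem_touchings {w : List (ℤ × ℤ)} {i j : ℕ} :
    (i, j) ∈ touchings w ↔ i < j ∧ j < w.length ∧
      (dmid w i - dmid w j).1 ^ 2 + (dmid w i - dmid w j).2 ^ 2 = 4 := by
  simp only [touchings, Finset.mem_filter, Finset.mem_product, Finset.mem_range]
  constructor
  · rintro ⟨⟨_, h2⟩, h3, h4⟩
    exact ⟨h3, h2, h4⟩
  · rintro ⟨h1, h2, h3⟩
    exact ⟨⟨h1.trans h2, h2⟩, h1, h3⟩

lemma card_touchings (w : List (ℤ × ℤ)) : (touchings w).card = Ham w := by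
  rw [touchings, Ham]

lemma dmid_append_left {v w : List (ℤ × ℤ)} {i : ℕ} (hi : i < v.length) :
    dmid (v ++ w) i = dmid v i := by
  rw [dmid, dmid, pt, pt, List.take_append_of_le_length hi.le, List.take_append_of_le_length hi]
  rfl

lemma dmid_append_right (v w : List (ℤ × ℤ)) (i : ℕ) :
    dmid (v ++ w) (v.length + i) = (v.sum + v.sum) + dmid w i := by
  have h : ∀ j, pt (v ++ w) (v.length + j) = v.sum + pt w j := fun j => by
    rw [pt, List.take_length_add_append, List.sum_append, pt]
  rw [dmid, add_assoc, h, h, dmid]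
  abel

lemma Ham_append_add_card_le (v w : List (ℤ × ℤ)) {J : Finset (ℕ × ℕ)}
    (hJ : J ⊆ touchings (v ++ w)) (hJ' : ∀ p ∈ J, p.1 < v.length ∧ v.length ≤ p.2) :
    Ham v + Ham w + J.card ≤ Ham (v ++ w) := by
  let e : ℕ × ℕ ↪ ℕ × ℕ := (addLeftEmbedding v.length).prodMap (addLeftEmbedding v.length)
  have hdisj : Disjoint (touchings v) ((touchings w).map e) := by
    rw [Finset.disjoint_left]
    rintro ⟨i, j⟩ h h'
    simp only [Finset.mem_map, Prod.exists] at h'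
    obtain ⟨a, c, -, h'⟩ := h'
    have := (mem_touchings.1 h).2.1
    have := (Prod.ext_iff.1 h').2
    simp [e] at this
    omega
  have hdisj' : Disjoint (touchings v ∪ (touchings w).map e) J := by
    rw [Finset.disjoint_left]
    rintro ⟨i, j⟩ h h'
    obtain ⟨h1, h2⟩ := hJ' _ h'
    dsimp only at h1 h2
    rcases Finset.mem_union.1 h with h | h
    · have := (mem_touchings.1 h).2.1
      omega
    · simp only [Finset.mem_map, Prod.exists] at h
      obtain ⟨a, c, -, h⟩ := h
      have := (Prod.ext_iff.1 h).1
      simp [e] at this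
      omega
  rw [← card_touchings v, ← card_touchings w, ← card_touchings (v ++ w),
    ← Finset.card_map e (s := touchings w), ← Finset.card_union_of_disjoint hdisj,
    ← Finset.card_union_of_disjoint hdisj']
  refine Finset.card_le_card (Finset.union_subset (Finset.union_subset ?_ ?_) hJ)
  · rintro ⟨i, j⟩ h
    obtain ⟨h1, h2, h3⟩ := mem_touchings.1 h
    rw [mem_touchings, dmid_append_left h2, dmid_append_left (h1.trans h2)]
    exact ⟨h1, by simp; omega, h3⟩
  · intro p hp
    obtain ⟨⟨i, j⟩, h, rfl⟩ := Finset.mem_map.1 hp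
    obtain ⟨h1, h2, h3⟩ := mem_touchings.1 h
    change (v.length + i, v.length + j) ∈ _
    rw [mem_touchings, dmid_append_right, dmid_append_right, add_sub_add_left_eq_sub]
    exact ⟨by omega, by simpa using h2, h3⟩

lemma Ham_append_le (v w : List (ℤ × ℤ)) : Ham v + Ham w ≤ Ham (v ++ w) := by
  simpa using Ham_append_add_card_le v w (J := ∅) (by simp) (by simp)

/-- A straight junction creates an additional touching. -/
lemma Ham_append_succ_le (v w : List (ℤ × ℤ)) (b : Bool) :
    Ham (v ++ [fwd b]) + Ham (fwd b :: w) + 1 ≤ Ham (v ++ [fwd b] ++ fwd b :: w) := by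
  refine Ham_append_add_card_le (v ++ [fwd b]) (fwd b :: w) (J := {(v.length, v.length + 1)}) ?_
    (by simp)
  rw [Finset.singleton_subset_iff, mem_touchings]
  refine ⟨by omega, by simp, ?_⟩
  have h1 : dmid (v ++ [fwd b] ++ fwd b :: w) v.length = (v.sum + v.sum) + fwd b := by
    rw [List.append_assoc]
    simpa [dmid, pt] using dmid_append_right v ([fwd b] ++ fwd b :: w) 0
  have h2 : dmid (v ++ [fwd b] ++ fwd b :: w) (v.length + 1) =
      (v.sum + fwd b + (v.sum + fwd b)) + fwd b := by
    simpa [dmid, pt] using dmid_append_right (v ++ [fwd b]) (fwd b :: w) 0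
  rw [h1, h2]
  cases b <;> simp [fwd] <;> ring

lemma Ham_append_singleton_le {v : List (ℤ × ℤ)} {d : ℤ × ℤ} (h : IsDirectedNE (v ++ [d])) :
    Ham (v ++ [d]) ≤ Ham v + 1 := by
  have hpt : ∀ i ≤ (v ++ [d]).length, (pt (v ++ [d]) i).1 + (pt (v ++ [d]) i).2 = i := by
    generalize v ++ [d] = w at h
    intro i hi
    induction i with
    | zero => simp [pt]
    | succ i ih =>
      obtain ⟨b, hb⟩ := h w[i] (List.getElem_mem _)
      have := ih (by omega)
      rw [pt, List.take_succ_eq_append_getElem hi, List.sum_append, hb]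
      rw [pt] at this
      cases b <;> simp [fwd] <;> omega
  rw [← card_touchings, ← card_touchings,
    ← Finset.card_singleton ((v.length - 1, v.length) : ℕ × ℕ)]
  refine (Finset.card_le_card ?_).trans (Finset.card_union_le _ _)
  rintro ⟨i, j⟩ hij
  obtain ⟨h1, h2, h3⟩ := mem_touchings.1 hij
  rw [Finset.mem_union, Finset.mem_singleton, mem_touchings]
  have h2' : j ≤ v.length := by simp at h2; omega
  rcases h2'.lt_or_eq with hj | rfl
  · rw [dmid_append_left hj, dmid_append_left (h1.trans hj)] at h3
    exact .inl ⟨h1, hj, h3⟩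
  · right
    have e1 := hpt i (by omega)
    have e2 := hpt (i + 1) (by omega)
    have e3 := hpt v.length (by omega)
    have e4 := hpt (v.length + 1) (by omega)
    simp only [dmid, Prod.fst_sub, Prod.snd_sub, Prod.fst_add, Prod.snd_add] at h3
    push_cast at e2 e4
    have key : ∀ a c : ℤ, a ^ 2 + c ^ 2 = 4 → -2 ≤ a + c := fun a c h => by
      by_contra! hlt
      nlinarith [sq_nonneg (a - c)]
    have := key _ _ h3
    rw [Prod.ext_iff]
    refine ⟨?_, rfl⟩
    dsimp only
    omega

/-! ## The Hamiltonian of a prudent path is at most linear in its length -/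

lemma IsPrudent.pt_ne {w : List (ℤ × ℤ)} (hw : IsPrudent w) {i j : ℕ} (hij : i < j)
    (hj : j ≤ w.length) : pt w j ≠ pt w i := by
  obtain ⟨j, rfl⟩ := Nat.exists_eq_succ_of_ne_zero (Nat.ne_zero_of_lt hij)
  have := hw j hj 1 le_rfl i (by omega)
  rwa [List.getD_eq_getElem _ _ hj, Nat.cast_one, one_smul, pt, ← List.sum_singleton (x := w[j]),
    ← List.sum_append, ← List.take_succ_eq_append_getElem hj] at this

lemma IsPrudent.dmid_ne {w : List (ℤ × ℤ)} (hw : IsPrudent w)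
    (hdir : ∀ d ∈ w, d ∈ Set.range dirs) {i j : ℕ} (hij : i < j) (hj : j < w.length) :
    dmid w i ≠ dmid w j := by
  intro h
  have hstep : ∀ k (hk : k < w.length), pt w (k + 1) = pt w k + w[k] := fun k hk => by
    rw [pt, List.take_succ_eq_append_getElem hk, List.sum_append, List.sum_singleton, pt]
  have h1 := hw.pt_ne hij hj.le
  have h2 := hw.pt_ne (hij.trans j.lt_succ_self) hj
  obtain ⟨a, ha⟩ := hdir _ (List.getElem_mem (hij.trans hj))
  obtain ⟨c, hc⟩ := hdir _ (List.getElem_mem hj)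
  rw [Nat.succ_eq_add_one, hstep j hj, ← hc] at h2
  simp only [dmid, hstep j hj, hstep i (hij.trans hj), ← ha, ← hc] at h
  rw [ne_eq, Prod.ext_iff] at h1 h2
  rw [Prod.ext_iff] at h
  fin_cases a <;> fin_cases c <;> simp [dirs] at h h1 h2 <;> omega

lemma IsPrudent.Ham_le {w : List (ℤ × ℤ)} (hw : IsPrudent w)
    (hdir : ∀ d ∈ w, d ∈ Set.range dirs) : Ham w ≤ 4 * w.length := by
  have hmap : ∀ p ∈ touchings w, p.2 ∈ Finset.range w.length := fun p hp =>
    Finset.mem_range.2 (mem_touchings.1 hp).2.1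
  rw [← card_touchings]
  refine (Finset.card_le_mul_card_image_of_maps_to hmap 4 fun j hj => ?_).trans_eq (by simp)
  let T : Finset (ℤ × ℤ) := {(2, 0), (-2, 0), (0, 2), (0, -2)}
  have hT : T.card = 4 := rfl
  rw [← hT]
  refine Finset.card_le_card_of_injOn (fun p => dmid w p.1 - dmid w j) ?_ ?_
  · rintro ⟨i, k⟩ hp
    simp only [Finset.mem_coe, Finset.mem_filter] at hp
    obtain ⟨hp, rfl⟩ := hp
    have h := (mem_touchings.1 hp).2.2
    generalize hx : dmid w i - dmid w k = x at h
    obtain ⟨x, y⟩ := x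
    have hx2 : x ≤ 2 := by nlinarith
    have hx2' : -2 ≤ x := by nlinarith
    have hy2 : y ≤ 2 := by nlinarith
    have hy2' : -2 ≤ y := by nlinarith
    simp only [hx, T]
    interval_cases x <;> interval_cases y <;> simp_all
  · rintro ⟨i, k⟩ hp ⟨i', k'⟩ hp' h
    simp only [Finset.mem_coe, Finset.mem_filter] at hp hp'
    obtain ⟨hp, rfl⟩ := hp
    obtain ⟨hp', rfl⟩ := hp'
    have h1 := mem_touchings.1 hp
    have h2 := mem_touchings.1 hp'
    have h : dmid w i = dmid w i' := by simpa using h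
    rcases lt_trichotomy i i' with hlt | rfl | hlt
    · exact absurd h (hw.dmid_ne hdir hlt (by omega))
    · rfl
    · exact absurd h.symm (hw.dmid_ne hdir hlt (by omega))

/-! ## The partition function as a sum over step sequences -/

lemma NETildeOf.mem_range_dirs {b : Bool} {w : List (ℤ × ℤ)} (h : NETildeOf b w) :
    ∀ d ∈ w, d ∈ Set.range dirs := by
  have hfwd : ∀ b, fwd b ∈ Set.range dirs := fun b => by
    cases b
    exacts [⟨0, rfl⟩, ⟨2, rfl⟩]
  have hneg : ∀ b, -fwd b ∈ Set.range dirs := fun b => by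
    cases b
    exacts [⟨1, rfl⟩, ⟨3, rfl⟩]
  have hrun : ∀ b x, ∀ d ∈ run b x, d ∈ Set.range dirs := fun b x d hd => by
    rw [List.eq_of_mem_replicate hd]
    split_ifs
    exacts [hfwd b, hneg b]
  have hblock : ∀ b ℓs, ∀ d ∈ blockSteps b ℓs, d ∈ Set.range dirs := fun b ℓs => by
    induction ℓs with
    | nil => simp
    | cons x t ih =>
      rcases eq_or_ne t [] with rfl | ht
      · simpa using hrun b x
      · intro d hd
        simp only [blockSteps_cons b x ht, List.mem_append, List.mem_cons] at hd
        rcases hd with hd | rfl | hd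
        exacts [hrun b x d hd, hfwd _, ih d hd]
  induction h with
  | first b ℓs _ _ _ => exact hblock b ℓs
  | next b w ℓs _ _ _ _ ih =>
    intro d hd
    rcases List.mem_append.1 hd with hd | hd
    exacts [ih d hd, hblock b ℓs d hd]

lemma length_stepsOf {L : ℕ} (s : Fin L → Fin 4) : (stepsOf s).length = L := by simp [stepsOf]

lemma stepsOf_injective (L : ℕ) : Function.Injective (stepsOf (L := L)) := by
  have hdirs : Function.Injective dirs := by decide
  exact (List.map_injective_iff.2 hdirs).comp List.ofFn_injective

open scoped Classical in
/-- The set `Ω̃_L^{NE,*}` as a set of step sequences. -/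
noncomputable def tildePaths (L : ℕ) : Finset (List (ℤ × ℤ)) := (neTildeFinset L).image stepsOf

lemma mem_tildePaths {L : ℕ} {w : List (ℤ × ℤ)} :
    w ∈ tildePaths L ↔ w.length = L ∧ ∃ b, NETildeOf b w := by
  classical
  simp only [tildePaths, neTildeFinset, Finset.mem_image, Finset.mem_filter, Finset.mem_univ,
    true_and, isNETilde_iff]
  constructor
  · rintro ⟨s, h, rfl⟩
    exact ⟨length_stepsOf s, h⟩
  · rintro ⟨rfl, b, h⟩
    obtain ⟨l, rfl⟩ : w ∈ Set.range (List.map dirs) := by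
      rw [Set.range_list_map]
      exact h.mem_range_dirs
    have hl : ∀ n (hn : n = l.length), stepsOf (fun i : Fin n => l.get (i.cast hn)) =
        l.map dirs := by
      rintro _ rfl
      simp only [stepsOf, Fin.cast_eq_self, List.ofFn_get]
    exact ⟨_, by rw [hl _ (by simp)]; exact ⟨b, h⟩, hl _ (by simp)⟩

lemma Ztilde_eq_sum_tildePaths (β : ℝ) (L : ℕ) :
    Ztilde β L = ∑ w ∈ tildePaths L, Real.exp (β * (Ham w : ℝ)) := by
  classical
  rw [tildePaths, Finset.sum_image (stepsOf_injective L).injOn, Ztilde]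

/-! ## Super-additivity -/

open scoped Classical in
/-- The concatenation of two paths, the last step of the second one being turned when this is
needed to stay in the class. -/
noncomputable def glue (v w : List (ℤ × ℤ)) : List (ℤ × ℤ) :=
  if ∃ b, NETildeOf b (v ++ w) then v ++ w else v ++ (w.dropLast ++ [w.headI])

lemma glue_eq_or {b c : Bool} {v w : List (ℤ × ℤ)} (hv : NETildeOf b v) (hw : NETildeOf c w) :
    ((∃ b', NETildeOf b' (v ++ w)) ∧ glue v w = v ++ w) ∨
    ∃ u, IsDirectedNE w ∧ w = fwd b :: u ++ [fwd !b] ∧ glue v w = v ++ (fwd b :: u ++ [fwd b]) := by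
  by_cases h : ∃ b', NETildeOf b' (v ++ w)
  · exact .inl ⟨h, if_pos h⟩
  · right
    obtain ⟨rfl, hdir⟩ := (hv.append hw).resolve_left h
    obtain ⟨u, hu⟩ := hw.eq_concat
    obtain ⟨t, ht⟩ := hw.eq_cons_of_directed hdir
    rw [Bool.not_not] at ht
    cases u with
    | nil =>
      rw [hu] at ht
      simp only [List.nil_append, List.cons.injEq] at ht
      exact absurd ht.1.symm (fwd_ne_fwd_not b)
    | cons d u =>
      obtain rfl : d = fwd b := by
        rw [hu] at ht
        simpa using congrArg List.headI ht
      refine ⟨u, hdir, hu, ?_⟩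
      rw [glue, if_neg h, hu, List.dropLast_concat]
      rfl

lemma exists_NETildeOf_glue {b c : Bool} {v w : List (ℤ × ℤ)} (hv : NETildeOf b v)
    (hw : NETildeOf c w) : ∃ b', NETildeOf b' (glue v w) := by
  rcases glue_eq_or hv hw with ⟨h, e⟩ | ⟨u, hdir, rfl, e⟩
  · rwa [e]
  · rw [e]
    exact ⟨b, hv.append_directed_fwd fun d hd => hdir d (List.mem_append_left _ hd)⟩

lemma length_glue {b c : Bool} {v w : List (ℤ × ℤ)} (hv : NETildeOf b v)
    (hw : NETildeOf c w) : (glue v w).length = v.length + w.length := by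
  rcases glue_eq_or hv hw with ⟨-, e⟩ | ⟨u, -, rfl, e⟩ <;> rw [e] <;> simp

lemma Ham_add_le_Ham_glue {b c : Bool} {v w : List (ℤ × ℤ)} (hv : NETildeOf b v)
    (hw : NETildeOf c w) : Ham v + Ham w ≤ Ham (glue v w) := by
  rcases glue_eq_or hv hw with ⟨-, e⟩ | ⟨u, hdir, rfl, e⟩
  · rw [e]
    exact Ham_append_le v w
  · rw [e]
    obtain ⟨t, rfl⟩ := hv.eq_concat
    have h1 := Ham_append_singleton_le hdir
    have h2 := Ham_append_succ_le t u b
    have h3 := Ham_append_le (t ++ [fwd b] ++ fwd b :: u) [fwd b]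
    rw [List.append_assoc (t ++ [fwd b])] at h3
    omega

/-- A path that has been modified by `glue` has left the class. -/
lemma not_NETildeOf_of_directed {b c : Bool} {u : List (ℤ × ℤ)}
    (hdir : IsDirectedNE (fwd b :: u ++ [fwd b])) : ¬ NETildeOf c (fwd b :: u ++ [fwd b]) := by
  intro h
  obtain ⟨s, hs⟩ := h.eq_concat
  obtain ⟨t, ht⟩ := h.eq_cons_of_directed hdir
  have h1 : fwd b = fwd c := by
    simpa using (List.append_inj' hs rfl).2
  have h2 : fwd b = fwd !c := by simpa using congrArg List.headI ht
  exact fwd_ne_fwd_not c (h1.symm.trans h2)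

lemma glue_injective {b c b' c' : Bool} {v w v' w' : List (ℤ × ℤ)} (hv : NETildeOf b v)
    (hw : NETildeOf c w) (hv' : NETildeOf b' v') (hw' : NETildeOf c' w')
    (hlen : v.length = v'.length) (h : glue v w = glue v' w') : v = v' ∧ w = w' := by
  have hturn : ∀ {b u}, IsDirectedNE (fwd b :: u ++ [fwd !b]) →
      IsDirectedNE (fwd b :: u ++ [fwd b]) := fun {b u} hdir d hd => by
    rcases List.mem_append.1 hd with hd | hd
    exacts [hdir d (List.mem_append_left _ hd), ⟨b, by simpa using hd⟩]
  rcases glue_eq_or hv hw with ⟨-, e⟩ | ⟨u, hdir, rfl, e⟩ <;>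
  rcases glue_eq_or hv' hw' with ⟨-, e'⟩ | ⟨u', hdir', rfl, e'⟩ <;>
  rw [e, e'] at h <;> obtain ⟨rfl, h'⟩ := List.append_inj h hlen
  · exact ⟨rfl, h'⟩
  · exact absurd (h' ▸ hw) (not_NETildeOf_of_directed (hturn hdir'))
  · exact absurd (h' ▸ hw') (not_NETildeOf_of_directed (hturn hdir))
  · obtain ⟨h1, h2⟩ := List.append_inj' h' rfl
    obtain rfl : b = b' := fwd_injective (by simpa using h2)
    exact ⟨rfl, by rw [h1]⟩

theorem Ztilde_mul_le {β : ℝ} (hβ : 0 ≤ β) (L L' : ℕ) :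
    Ztilde β L * Ztilde β L' ≤ Ztilde β (L + L') := by
  classical
  simp only [Ztilde_eq_sum_tildePaths]
  rw [Finset.sum_mul_sum, ← Finset.sum_product']
  calc ∑ p ∈ tildePaths L ×ˢ tildePaths L', Real.exp (β * Ham p.1) * Real.exp (β * Ham p.2)
      ≤ ∑ p ∈ tildePaths L ×ˢ tildePaths L', Real.exp (β * Ham (glue p.1 p.2)) := by
        refine Finset.sum_le_sum fun p hp => ?_
        rw [Finset.mem_product, mem_tildePaths, mem_tildePaths] at hp
        obtain ⟨⟨-, b, hv⟩, -, c, hw⟩ := hp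
        rw [← Real.exp_add, ← mul_add]
        gcongr
        exact_mod_cast Ham_add_le_Ham_glue hv hw
    _ = ∑ w ∈ (tildePaths L ×ˢ tildePaths L').image fun p => glue p.1 p.2,
          Real.exp (β * Ham w) := by
        rw [Finset.sum_image]
        rintro ⟨v, w⟩ hp ⟨v', w'⟩ hp' h
        simp only [Finset.mem_coe, Finset.mem_product, mem_tildePaths] at hp hp'
        obtain ⟨⟨h1, b, hv⟩, -, c, hw⟩ := hp
        obtain ⟨⟨h2, b', hv'⟩, -, c', hw'⟩ := hp'
        exact Prod.ext_iff.2 (glue_injective hv hw hv' hw' (h1.trans h2.symm) h)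
    _ ≤ ∑ w ∈ tildePaths (L + L'), Real.exp (β * Ham w) := by
        refine Finset.sum_le_sum_of_subset_of_nonneg ?_ fun _ _ _ => (Real.exp_pos _).le
        intro x hx
        obtain ⟨⟨v, w⟩, hp, rfl⟩ := Finset.mem_image.1 hx
        simp only [Finset.mem_product, mem_tildePaths] at hp
        obtain ⟨⟨rfl, b, hv⟩, rfl, c, hw⟩ := hp
        exact mem_tildePaths.2 ⟨length_glue hv hw, exists_NETildeOf_glue hv hw⟩

/-! ## The free energy -/

lemma Ztilde_le_succ {β : ℝ} (hβ : 0 ≤ β) (L : ℕ) : Ztilde β L ≤ Ztilde β (L + 1) := by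
  classical
  simp only [Ztilde_eq_sum_tildePaths]
  have hlast : ∀ {b w}, NETildeOf b w → w.getLast? = some (fwd b) := fun h => by
    obtain ⟨u, rfl⟩ := h.eq_concat
    simp
  calc ∑ w ∈ tildePaths L, Real.exp (β * Ham w)
      ≤ ∑ w ∈ tildePaths L, Real.exp (β * Ham (w ++ w.getLast?.toList)) := by
        refine Finset.sum_le_sum fun w _ => ?_
        gcongr
        exact (Nat.le_add_right _ _).trans (Ham_append_le _ _)
    _ = ∑ w ∈ (tildePaths L).image fun w => w ++ w.getLast?.toList, Real.exp (β * Ham w) := by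
        rw [Finset.sum_image]
        intro v hv w hw h
        simp only [Finset.mem_coe, mem_tildePaths] at hv hw
        exact (List.append_inj h (hv.1.trans hw.1.symm)).1
    _ ≤ _ := by
        refine Finset.sum_le_sum_of_subset_of_nonneg ?_ fun _ _ _ => (Real.exp_pos _).le
        intro x hx
        obtain ⟨w, hw, rfl⟩ := Finset.mem_image.1 hx
        obtain ⟨rfl, b, hw⟩ := mem_tildePaths.1 hw
        rw [hlast hw]
        exact mem_tildePaths.2 ⟨by simp, b, hw.append_fwd⟩

lemma one_le_Ztilde {β : ℝ} (hβ : 0 ≤ β) {L : ℕ} (hL : 2 ≤ L) : 1 ≤ Ztilde β L := by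
  refine le_trans ?_ (monotone_nat_of_le_succ (Ztilde_le_succ hβ) hL)
  have hmem : blockSteps true [0, 1] ∈ tildePaths 2 := mem_tildePaths.2 ⟨rfl, true,
    .first true [0, 1] (by simp) rfl
      (upperExit_replicate_zero_append 1 (upperExit_singleton zero_lt_one) (by simp))⟩
  rw [Ztilde_eq_sum_tildePaths]
  refine (Real.one_le_exp (by positivity)).trans
    (Finset.single_le_sum (fun _ _ => (Real.exp_pos _).le) hmem)

lemma Ztilde_nonneg (β : ℝ) (L : ℕ) : 0 ≤ Ztilde β L :=
  Finset.sum_nonneg fun _ _ => (Real.exp_pos _).le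

lemma Ztilde_eq_zero (β : ℝ) {L : ℕ} (hL : L < 2) : Ztilde β L = 0 := by
  rw [Ztilde_eq_sum_tildePaths, Finset.sum_eq_zero]
  intro w hw
  obtain ⟨rfl, b, h⟩ := mem_tildePaths.1 hw
  exfalso
  cases h with
  | first _ ℓs h1 h2 h3 =>
    obtain ⟨x, t, y, rfl, hy⟩ := h3.exists_eq h1 h2.le
    rw [blockSteps_append b (by simp) (by simp)] at hL
    simp [run] at hL
    omega
  | next _ w ℓs h0 h1 h2 h3 =>
    obtain ⟨x, t, y, rfl, hy⟩ := h3.exists_eq h1 h2.le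
    rw [blockSteps_append b (by simp) (by simp)] at hL
    simp [run] at hL
    omega

lemma log_Ztilde_nonneg {β : ℝ} (hβ : 0 ≤ β) (L : ℕ) : 0 ≤ Real.log (Ztilde β L) := by
  rcases lt_or_ge L 2 with h | h
  · simp [Ztilde_eq_zero β h]
  · exact Real.log_nonneg (one_le_Ztilde hβ h)

lemma log_Ztilde_add_le {β : ℝ} (hβ : 0 ≤ β) (L L' : ℕ) :
    Real.log (Ztilde β L) + Real.log (Ztilde β L') ≤ Real.log (Ztilde β (L + L')) := by
  have hmono : ∀ m n, m ≤ n → Real.log (Ztilde β m) ≤ Real.log (Ztilde β n) := fun m n hmn => by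
    rcases lt_or_ge m 2 with h | h
    · simpa [Ztilde_eq_zero β h] using log_Ztilde_nonneg hβ n
    · exact Real.log_le_log (zero_lt_one.trans_le (one_le_Ztilde hβ h))
        (monotone_nat_of_le_succ (Ztilde_le_succ hβ) hmn)
  rcases lt_or_ge L 2 with h | h
  · simpa [Ztilde_eq_zero β h] using hmono L' _ (Nat.le_add_left _ _)
  rcases lt_or_ge L' 2 with h' | h'
  · simpa [Ztilde_eq_zero β h'] using hmono L _ (Nat.le_add_right _ _)
  have h1 := zero_lt_one.trans_le (one_le_Ztilde hβ h)
  have h2 := zero_lt_one.trans_le (one_le_Ztilde hβ h')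
  rw [← Real.log_mul h1.ne' h2.ne']
  exact Real.log_le_log (mul_pos h1 h2) (Ztilde_mul_le hβ L L')

lemma Ztilde_le {β : ℝ} (hβ : 0 ≤ β) (L : ℕ) :
    Ztilde β L ≤ Real.exp (L * (Real.log 4 + β * 4)) := by
  have hcard : (tildePaths L).card ≤ 4 ^ L := by
    classical
    refine Finset.card_image_le.trans ((Finset.card_le_univ _).trans_eq (by simp))
  have hterm : ∀ w ∈ tildePaths L, Real.exp (β * Ham w) ≤ Real.exp (β * (4 * L)) := fun w hw => by
    obtain ⟨rfl, b, h⟩ := mem_tildePaths.1 hw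
    gcongr
    exact_mod_cast h.prudent_and_corner.1.Ham_le h.mem_range_dirs
  rw [Ztilde_eq_sum_tildePaths]
  calc _ ≤ (tildePaths L).card • Real.exp (β * (4 * L)) := Finset.sum_le_card_nsmul _ _ _ hterm
    _ ≤ (4 : ℝ) ^ L * Real.exp (β * (4 * L)) := by
        rw [nsmul_eq_mul]
        gcongr
        exact_mod_cast hcard
    _ = Real.exp (L * (Real.log 4 + β * 4)) := by
        rw [mul_add, Real.exp_add, Real.exp_nat_mul, Real.exp_log (by norm_num)]
        ring_nf

lemma log_Ztilde_div_le {β : ℝ} (hβ : 0 ≤ β) (L : ℕ) :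
    Real.log (Ztilde β L) / L ≤ Real.log 4 + β * 4 := by
  have h0 : 0 ≤ Real.log 4 + β * 4 := by
    have := Real.log_nonneg (show (1 : ℝ) ≤ 4 by norm_num)
    positivity
  refine div_le_of_le_mul₀ L.cast_nonneg h0 ?_
  rcases (Ztilde_nonneg β L).eq_or_lt with h | h
  · rw [← h, Real.log_zero]
    positivity
  · rw [Real.log_le_iff_le_exp h, mul_comm]
    exact Ztilde_le hβ L

/-- For every `β ≥ 0` the sequence `Z̃^{NE,*}_{β,L}` is log super-additive and
consequently its free energy exists, is finite, and equals
`sup_L (1/L) log Z̃^{NE,*}_{β,L}`. -/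
theorem Ztilde_superadditive_and_free_energy (β : ℝ) (hβ : 0 ≤ β) :
    (∀ L L' : ℕ, Ztilde β L * Ztilde β L' ≤ Ztilde β (L + L')) ∧
    ∃ F : ℝ,
      Tendsto (fun L : ℕ => Real.log (Ztilde β L) / (L : ℝ)) atTop (nhds F) ∧
      F = ⨆ L : ℕ, Real.log (Ztilde β L) / (L : ℝ) := by
  refine ⟨Ztilde_mul_le hβ, ?_⟩
  have hsub : Subadditive fun L => -Real.log (Ztilde β L) := fun L L' => by
    have := log_Ztilde_add_le hβ L L'
    dsimp only
    linarith
  have hbdd : BddBelow (Set.range fun L : ℕ => -Real.log (Ztilde β L) / (L : ℝ)) := by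
    refine ⟨-(Real.log 4 + β * 4), ?_⟩
    rintro _ ⟨L, rfl⟩
    simpa [neg_div] using log_Ztilde_div_le hβ L
  have hbdd' : BddAbove (Set.range fun L : ℕ => Real.log (Ztilde β L) / (L : ℝ)) := by
    refine ⟨Real.log 4 + β * 4, ?_⟩
    rintro _ ⟨L, rfl⟩
    exact log_Ztilde_div_le hβ L
  have htend : Tendsto (fun L : ℕ => Real.log (Ztilde β L) / (L : ℝ)) atTop (nhds (-hsub.lim)) := by
    simpa [neg_div] using (hsub.tendsto_lim hbdd).neg
  have hle : ∀ L : ℕ, L ≠ 0 → Real.log (Ztilde β L) / (L : ℝ) ≤ -hsub.lim := fun L hL => by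
    have := hsub.lim_le_div hbdd hL
    rw [neg_div] at this
    linarith
  refine ⟨-hsub.lim, htend, le_antisymm (le_of_tendsto' htend fun L => le_ciSup hbdd' L)
    (ciSup_le fun L => ?_)⟩
  rcases eq_or_ne L 0 with rfl | hL
  · have := hle 1 one_ne_zero
    simpa using (div_nonneg (log_Ztilde_nonneg hβ 1) (Nat.cast_nonneg 1)).trans this
  · exact hle L hL
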